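/- arXiv:2604.07515 — 2 statements merged into one kernel-verified Lean document; each statement's English description precedes it below -/
import Mathlib

section
/- Run InfluenceMIS on a finite simple graph G on n vertices with initial undecided vertex set V_1^? = ∅ and an initial undecided edge set E_1^? of size b, where the permutation π is drawn uniformly at random from all permutations of the vertex set. Then for every iteration i with 1 ≤ i < n/4, the probability that the vertex π(i) processed at iteration i is added to the influence set is at most 8bi/n². -/
open Finset

/-- `lfmisAux W E π i` : the vertex at π-position `i` is in the greedy
lexicographically-first MIS of the graph with vertex set `W` and edge set `E`. -/
def lfmisAux {n : ℕ} (W : Set (Fin n)) (E : Set (Sym2 (Fin n))) (π : Equiv.Perm (Fin n))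
    (i : ℕ) : Prop :=
  (∃ h : i < n, π ⟨i, h⟩ ∈ W) ∧
    ∀ j, j < i →
      (∃ (h1 : j < n) (h2 : i < n), π ⟨j, h1⟩ ∈ W ∧ π ⟨i, h2⟩ ∈ W ∧
        s(π ⟨j, h1⟩, π ⟨i, h2⟩) ∈ E) → ¬ lfmisAux W E π j
termination_by i

/-- The lexicographically-first MIS of the graph with vertex set `W ⊆ Fin n`
and edge set `E`, under the permutation `π` (position `i` holds vertex `π i`). -/
def LFMISOn {n : ℕ} (W : Set (Fin n)) (E : Set (Sym2 (Fin n)))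
    (π : Equiv.Perm (Fin n)) : Set (Fin n) :=
  {v | v ∈ W ∧ lfmisAux W E π (π.symm v : ℕ)}

/-- State of the `InfluenceMIS` procedure: alive vertices, surviving edges,
undecided vertices, undecided edges. -/
structure MISState (n : ℕ) where
  verts : Finset (Fin n)
  edges : Finset (Sym2 (Fin n))
  uV : Finset (Fin n)
  uE : Finset (Sym2 (Fin n))

/-- Current neighbors of `u`. -/
def MISState.nbrs {n : ℕ} (st : MISState n) (u : Fin n) : Finset (Fin n) :=
  st.verts.filter fun v => v ≠ u ∧ s(u, v) ∈ st.edges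

/-- One iteration of `InfluenceMIS`, processing vertex `u`.  If `u` is not alive,
nothing happens.  If `u` is undecided, all of its neighbors become undecided and
`u` is deleted (it joins the influence set).  Otherwise `u` is (implicitly) added
to the MIS: its neighbors along undecided edges become undecided, its neighbors
along decided edges are deleted, and `u` is deleted. -/
def stepInf {n : ℕ} (st : MISState n) (u : Fin n) : MISState n :=
  if u ∉ st.verts then st
  else if u ∈ st.uV then
    { verts := st.verts.erase u
      edges := st.edges.filter fun e => u ∉ e
      uV := (st.uV ∪ st.nbrs u).erase u
      uE := st.uE.filter fun e => u ∉ e }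
  else
    let D := (st.nbrs u).filter fun v => s(u, v) ∉ st.uE
    let U := (st.nbrs u).filter fun v => s(u, v) ∈ st.uE
    { verts := (st.verts.erase u) \ D
      edges := st.edges.filter fun e => u ∉ e ∧ ∀ v ∈ D, v ∉ e
      uV := ((st.uV ∪ U) \ D).erase u
      uE := st.uE.filter fun e => u ∉ e ∧ ∀ v ∈ D, v ∉ e }

/-- `stateAt π st0 i` : the state at the beginning of (0-based) iteration `i`
of `InfluenceMIS` started from `st0`, where position `i` holds vertex `π i`
(so 1-based iteration `i` of the paper corresponds to `stateAt π st0 (i-1)`). -/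
def stateAt {n : ℕ} (π : Equiv.Perm (Fin n)) (st0 : MISState n) : ℕ → MISState n
  | 0 => st0
  | i + 1 => if h : i < n then stepInf (stateAt π st0 i) (π ⟨i, h⟩) else stateAt π st0 i

/-- The influence set returned by `InfluenceMIS`: vertices that are alive and
undecided at the beginning of their own iteration. -/
def influenceMIS {n : ℕ} (π : Equiv.Perm (Fin n)) (st0 : MISState n) : Finset (Fin n) :=
  Finset.univ.filter fun v =>
    v ∈ (stateAt π st0 (π.symm v : ℕ)).verts ∧ v ∈ (stateAt π st0 (π.symm v : ℕ)).uV

/-- Initial state of `InfluenceMIS` on a graph `G` with undecided vertices `uV`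
and undecided edges `uE`. -/
def initState {n : ℕ} (G : SimpleGraph (Fin n)) [DecidableRel G.Adj]
    (uV : Finset (Fin n)) (uE : Finset (Sym2 (Fin n))) : MISState n :=
  ⟨Finset.univ, G.edgeFinset, uV, uE⟩

/-- The alive undecided vertices of a state. -/
def MISState.active {n : ℕ} (st : MISState n) : Finset (Fin n) :=
  st.verts ∩ st.uV

theorem stepInf_of_notMem {n : ℕ} (st : MISState n) {u : Fin n} (hu : u ∉ st.verts) :
    stepInf st u = st := by
  simp [stepInf, hu]

theorem stepInf_verts_subset {n : ℕ} (st : MISState n) (u : Fin n) :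
    (stepInf st u).verts ⊆ st.verts.erase u := by
  unfold stepInf
  split_ifs with h1 h2
  · exact Subset.rfl
  · exact sdiff_subset
  · exact (erase_eq_of_notMem h1).ge

theorem stepInf_uE_subset {n : ℕ} (st : MISState n) (u : Fin n) :
    (stepInf st u).uE ⊆ st.uE := by
  unfold stepInf
  split_ifs
  · exact filter_subset _ _
  · exact filter_subset _ _
  · exact Subset.rfl

theorem stateAt_succ {n : ℕ} (π : Equiv.Perm (Fin n)) (st : MISState n) (t : Fin n) :
    stateAt π st (t + 1) = stepInf (stateAt π st t) (π t) := by
  simp [stateAt]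

theorem stateAt_congr {n : ℕ} {π ρ : Equiv.Perm (Fin n)} (st : MISState n) (t : ℕ)
    (h : ∀ j : Fin n, (j : ℕ) < t → π j = ρ j) : stateAt π st t = stateAt ρ st t := by
  induction t with
  | zero => rfl
  | succ t ih =>
    have ih := ih fun j hj => h j (by omega)
    simp only [stateAt]
    split_ifs with ht
    · rw [ih, h ⟨t, ht⟩ (Nat.lt_succ_self t)]
    · exact ih

theorem notMem_verts_stateAt {n : ℕ} (π : Equiv.Perm (Fin n)) (st : MISState n) (t : ℕ)
    (j : Fin n) (hj : (j : ℕ) < t) : π j ∉ (stateAt π st t).verts := by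
  induction t with
  | zero => omega
  | succ t ih =>
    simp only [stateAt]
    split_ifs with ht
    · intro hmem
      have hmem := mem_erase.1 (stepInf_verts_subset _ _ hmem)
      rcases Nat.lt_succ_iff_lt_or_eq.1 hj with h | h
      · exact ih h hmem.2
      · exact hmem.1 (congrArg π (Fin.ext h))
    · exact ih (by omega)

theorem stateAt_uE_subset {n : ℕ} (π : Equiv.Perm (Fin n)) (st : MISState n) (t : ℕ) :
    (stateAt π st t).uE ⊆ st.uE := by
  induction t with
  | zero => exact Subset.rfl
  | succ t ih =>
    simp only [stateAt]
    split_ifs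
    · exact (stepInf_uE_subset _ _).trans ih
    · exact ih

theorem card_pairs_mem_le {α : Type*} [Fintype α] [DecidableEq α] (E : Finset (Sym2 α)) :
    #{p : α × α | s(p.1, p.2) ∈ E} ≤ 2 * #E := by
  refine card_le_mul_card_image_of_maps_to (f := fun p : α × α => s(p.1, p.2))
    (fun p hp => (mem_filter.1 hp).2) 2 fun e _ => ?_
  induction e with
  | _ a b =>
    refine (card_le_card (t := {(a, b), (b, a)}) ?_).trans card_le_two
    rintro ⟨x, y⟩ h
    simpa using (mem_filter.1 h).2

/-- Adjacency in the alive part of a state. -/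
def MISState.AliveAdj {n : ℕ} (st : MISState n) (u v : Fin n) : Prop :=
  u ∈ st.verts ∧ v ∈ st.verts ∧ v ≠ u ∧ s(u, v) ∈ st.edges

instance {n : ℕ} (st : MISState n) : DecidableRel st.AliveAdj := fun _ _ =>
  inferInstanceAs (Decidable (_ ∧ _))

theorem MISState.AliveAdj.comm {n : ℕ} (st : MISState n) (u v : Fin n) :
    st.AliveAdj u v ↔ st.AliveAdj v u := by
  unfold MISState.AliveAdj
  rw [Sym2.eq_swap (a := u)]
  tauto

theorem card_active_stepInf_add_le {n : ℕ} (st : MISState n) (u : Fin n) :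
    #(stepInf st u).active
        + #{v | st.AliveAdj u v ∧ u ∉ st.uV ∧ v ∈ st.uV ∧ s(u, v) ∉ st.uE} ≤
      #st.active + #{v | st.AliveAdj u v ∧ u ∈ st.uV ∧ v ∉ st.uV}
        + #{v | st.AliveAdj u v ∧ u ∉ st.uV ∧ v ∉ st.uV ∧ s(u, v) ∈ st.uE} := by
  have key : (stepInf st u).active ∪
      ({v | st.AliveAdj u v ∧ u ∉ st.uV ∧ v ∈ st.uV ∧ s(u, v) ∉ st.uE} : Finset (Fin n)) ⊆
      st.active ∪ ({v | st.AliveAdj u v ∧ u ∈ st.uV ∧ v ∉ st.uV} : Finset (Fin n)) ∪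
        ({v | st.AliveAdj u v ∧ u ∉ st.uV ∧ v ∉ st.uV ∧ s(u, v) ∈ st.uE} : Finset (Fin n)) := by
    intro v
    unfold stepInf MISState.active MISState.AliveAdj MISState.nbrs
    split_ifs <;> simp <;> tauto
  have hdisj : Disjoint (stepInf st u).active
      ({v | st.AliveAdj u v ∧ u ∉ st.uV ∧ v ∈ st.uV ∧ s(u, v) ∉ st.uE} : Finset (Fin n)) := by
    rw [disjoint_left]
    intro v
    unfold stepInf MISState.active MISState.AliveAdj MISState.nbrs
    split_ifs <;> simp <;> tauto
  rw [← card_union_of_disjoint hdisj]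
  exact (card_le_card key).trans
    ((card_union_le _ _).trans (Nat.add_le_add_right (card_union_le _ _) _))

theorem sum_card_active_stepInf_le {n : ℕ} (st : MISState n) :
    ∑ u, #(stepInf st u).active ≤ n * #st.active + 2 * #st.uE := by
  have hsum := sum_le_sum fun u (_ : u ∈ univ) => card_active_stepInf_add_le st u
  simp only [sum_add_distrib, sum_const, card_univ, Fintype.card_fin, smul_eq_mul] at hsum
  have hswap : ∑ u, #{v | st.AliveAdj u v ∧ u ∈ st.uV ∧ v ∉ st.uV} =
      ∑ u, #{v | st.AliveAdj u v ∧ u ∉ st.uV ∧ v ∈ st.uV} := by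
    simp only [card_filter]
    rw [sum_comm]
    refine sum_congr rfl fun u _ => sum_congr rfl fun v _ => ?_
    simp only [MISState.AliveAdj.comm st v u, and_comm (a := v ∈ st.uV)]
  have hpairs : ∑ u, #{v | s(u, v) ∈ st.uE} ≤ 2 * #st.uE := by
    refine le_trans (le_of_eq ?_) (card_pairs_mem_le st.uE)
    simp only [card_filter, Fintype.sum_prod_type]
  have hsplit : ∑ u, #{v | st.AliveAdj u v ∧ u ∉ st.uV ∧ v ∈ st.uV} +
      ∑ u, #{v | st.AliveAdj u v ∧ u ∉ st.uV ∧ v ∉ st.uV ∧ s(u, v) ∈ st.uE} ≤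
      ∑ u, #{v | st.AliveAdj u v ∧ u ∉ st.uV ∧ v ∈ st.uV ∧ s(u, v) ∉ st.uE} +
        ∑ u, #{v | s(u, v) ∈ st.uE} := by
    simp only [card_filter, ← sum_add_distrib]
    refine sum_le_sum fun u _ => sum_le_sum fun v _ => ?_
    by_cases ha : st.AliveAdj u v <;> by_cases hu : u ∈ st.uV <;> by_cases hv : v ∈ st.uV <;>
      by_cases he : s(u, v) ∈ st.uE <;> simp [ha, hu, hv, he]
  omega

/-- Exchangeability of the unprocessed positions of a uniformly random permutation. -/
theorem sum_perm_apply_eq {n : ℕ} (t : Fin n) (f : Equiv.Perm (Fin n) → Fin n → ℝ)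
    (hf : ∀ π ρ : Equiv.Perm (Fin n), (∀ j < t, π j = ρ j) → f π = f ρ)
    (h0 : ∀ π : Equiv.Perm (Fin n), ∀ j < t, f π (π j) = 0) :
    ((n : ℝ) - (t : ℕ)) * ∑ π, f π (π t) = ∑ π, ∑ v, f π v := by
  have hswap (j : Fin n) (hj : j ∈ Ici t) :
      ∑ π : Equiv.Perm (Fin n), f π (π j) = ∑ π, f π (π t) := by
    rw [← Equiv.sum_comp (Equiv.mulRight (Equiv.swap t j)) fun π => f π (π t)]
    refine sum_congr rfl fun π _ => ?_
    rw [hf π (π * Equiv.swap t j)]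
    · simp
    · intro k hk
      have hkj : k < j := hk.trans_le (mem_Ici.1 hj)
      simp [Equiv.swap_apply_of_ne_of_ne hk.ne hkj.ne]
  have hcard : ((n : ℝ) - (t : ℕ)) = #(Ici t) := by
    rw [Fin.card_Ici, Nat.cast_sub t.2.le]
  rw [hcard, ← nsmul_eq_mul, ← sum_const, ← sum_congr rfl hswap, sum_comm]
  refine sum_congr rfl fun π _ => ?_
  rw [← Equiv.sum_comp π (f π)]
  refine sum_subset (subset_univ _) fun j _ hj => h0 π j ?_
  simpa using hj

theorem sum_card_active_stateAt_succ_le {n : ℕ} (st : MISState n) (t : Fin n) :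
    ((n : ℝ) - (t : ℕ)) * (∑ π, (#(stateAt π st (t + 1)).active : ℝ) -
        ∑ π, (#(stateAt π st t).active : ℝ)) ≤
      Fintype.card (Equiv.Perm (Fin n)) * (2 * (#st.uE : ℝ)) := by
  have h := sum_perm_apply_eq t
    (fun π u => (#(stepInf (stateAt π st t) u).active : ℝ) - #(stateAt π st t).active)
    (fun π ρ hπ => by simp only [stateAt_congr st t hπ])
    (fun π j hj => by
      simp only [stepInf_of_notMem _ (notMem_verts_stateAt π st t j hj), sub_self])
  simp only [stateAt_succ, ← sum_sub_distrib]
  rw [h, ← nsmul_eq_mul, ← card_univ]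
  refine sum_le_card_nsmul _ _ _ fun π _ => ?_
  have h1 := sum_card_active_stepInf_le (stateAt π st t)
  have h2 := card_le_card (stateAt_uE_subset π st t)
  have h3 : ∑ u, #(stepInf (stateAt π st t) u).active ≤
      n * #(stateAt π st t).active + 2 * #st.uE := by omega
  have h4 : ∑ u, (#(stepInf (stateAt π st t) u).active : ℝ) ≤
      n * #(stateAt π st t).active + 2 * #st.uE := by exact_mod_cast h3
  rw [sum_sub_distrib, sum_const, card_univ, Fintype.card_fin, nsmul_eq_mul]
  linarith

theorem card_filter_apply_mem_active {n : ℕ} (st : MISState n) (t : Fin n) :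
    ((n : ℝ) - (t : ℕ)) *
        (#{π : Equiv.Perm (Fin n) | π t ∈ (stateAt π st t).active} : ℝ) =
      ∑ π, (#(stateAt π st t).active : ℝ) := by
  have h := sum_perm_apply_eq t
    (fun π u => if u ∈ (stateAt π st t).active then (1 : ℝ) else 0)
    (fun π ρ hπ => by simp only [stateAt_congr st t hπ])
    (fun π j hj => if_neg fun hmem =>
      notMem_verts_stateAt π st t j hj (mem_inter.1 hmem).1)
  simpa using h

theorem sum_card_active_stateAt_le {n : ℕ} (st : MISState n) (hst : st.active = ∅) (t : ℕ)
    (ht : (t : ℝ) < n / 4) :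
    3 * (n : ℝ) * ∑ π, (#(stateAt π st t).active : ℝ) ≤
      Fintype.card (Equiv.Perm (Fin n)) * (8 * (#st.uE : ℝ) * t) := by
  induction t with
  | zero => simp [stateAt, hst]
  | succ t ih =>
    push_cast at ht ⊢
    have ht0 : (0 : ℝ) ≤ t := t.cast_nonneg
    have htn : t < n := by
      have : (t : ℝ) < n := by linarith
      exact_mod_cast this
    have ih := ih (by linarith)
    have hstep := sum_card_active_stateAt_succ_le st ⟨t, htn⟩
    simp only at hstep
    set F : ℝ := (Fintype.card (Equiv.Perm (Fin n)) : ℝ)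
    have hF : 0 ≤ F * (2 * (#st.uE : ℝ)) := by positivity
    set D := ∑ π, (#(stateAt π st (t + 1)).active : ℝ) - ∑ π, (#(stateAt π st t).active : ℝ)
      with hD
    have hD' : 3 * (n : ℝ) * D ≤ 4 * (F * (2 * (#st.uE : ℝ))) := by
      rcases le_total D 0 with hneg | hpos
      · nlinarith [mul_nonneg (n.cast_nonneg (α := ℝ)) (neg_nonneg.2 hneg)]
      · nlinarith
    nlinarith

/-- Run `InfluenceMIS` with `V₁? = ∅` and `|E₁?| = b` over a uniformly random
permutation.  For every iteration `i` (1-based) with `1 ≤ i < n/4`, the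
probability that the vertex `π(i)` processed at iteration `i` is added to the
influence set (i.e. is alive and undecided at the beginning of iteration `i`)
is at most `8·b·i/n²` (stated with counting measure: `n!` times the bound). -/
theorem prob_influence_step_le {n : ℕ} (G : SimpleGraph (Fin n)) [DecidableRel G.Adj]
    (uE : Finset (Sym2 (Fin n))) (huE : uE ⊆ G.edgeFinset)
    (b : ℕ) (hb : uE.card = b)
    (i : ℕ) (h1 : 1 ≤ i) (h2 : (i : ℝ) < (n : ℝ) / 4) :
    ((Finset.univ.filter fun π : Equiv.Perm (Fin n) =>
        ∃ v : Fin n, (π.symm v : ℕ) + 1 = i ∧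
          v ∈ (stateAt π (initState G ∅ uE) (i - 1)).verts ∧
          v ∈ (stateAt π (initState G ∅ uE) (i - 1)).uV).card : ℝ)
      ≤ (Fintype.card (Equiv.Perm (Fin n)) : ℝ) *
          (8 * (b : ℝ) * (i : ℝ) / (n : ℝ) ^ 2) := by
  obtain ⟨t, rfl⟩ : ∃ t, i = t + 1 := ⟨i - 1, by omega⟩
  rw [Nat.cast_add_one] at h2 ⊢
  have ht0 : (0 : ℝ) ≤ t := t.cast_nonneg
  have hn : (0 : ℝ) < n := by linarith
  have htn : t < n := by
    have : (t : ℝ) < n := by linarith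
    exact_mod_cast this
  have hcount := card_filter_apply_mem_active (initState G ∅ uE) ⟨t, htn⟩
  have hsum := sum_card_active_stateAt_le (initState G ∅ uE)
    (by simp [MISState.active, initState]) t (by linarith)
  rw [← hcount, show (initState G ∅ uE).uE = uE from rfl, hb] at hsum
  have hset : (univ.filter fun π : Equiv.Perm (Fin n) =>
        ∃ v : Fin n, (π.symm v : ℕ) + 1 = t + 1 ∧
          v ∈ (stateAt π (initState G ∅ uE) (t + 1 - 1)).verts ∧
          v ∈ (stateAt π (initState G ∅ uE) (t + 1 - 1)).uV) =
      univ.filter fun π : Equiv.Perm (Fin n) =>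
        π ⟨t, htn⟩ ∈ (stateAt π (initState G ∅ uE) t).active := by
    refine filter_congr fun π _ => ?_
    rw [MISState.active, mem_inter, Nat.add_sub_cancel]
    constructor
    · rintro ⟨v, hv, hmem⟩
      have hv' : v = π ⟨t, htn⟩ := by
        rw [← Equiv.symm_apply_eq]
        exact Fin.ext (Nat.succ_injective hv)
      exact hv' ▸ hmem
    · exact fun hmem => ⟨_, by simp, hmem⟩
  rw [hset, mul_div_assoc', le_div_iff₀ (by positivity)]
  simp only at hsum
  set C : ℝ := (#{π : Equiv.Perm (Fin n) |
    π ⟨t, htn⟩ ∈ (stateAt π (initState G ∅ uE) t).active} : ℝ)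
  set F : ℝ := (Fintype.card (Equiv.Perm (Fin n)) : ℝ)
  have hC : 0 ≤ C := Nat.cast_nonneg _
  have hFb : 0 ≤ F * b := by positivity
  have hlow : 9 / 4 * (C * n ^ 2) ≤ 3 * n * ((n - t) * C) := by
    have : 0 ≤ 3 * n * C * ((n - t) - 3 / 4 * n) :=
      mul_nonneg (by positivity) (by linarith)
    linarith
  have hFbt : 0 ≤ F * b * t := mul_nonneg hFb ht0
  have hCn : 0 ≤ C * (n : ℝ) ^ 2 := by positivity
  linarith
end

section
/- There exist a finite simple graph G, a permutation π of its vertices, and two edges a and b not in G, such that some vertex w lies in the batch influence set for inserting {a, b} into G, but w lies neither in the CHK influence set for inserting a alone into G, nor in the CHK influence set for inserting b alone into G + a. (Hence the batch influence set is not always covered by the union of the influence sets of applying the updates one at a time sequentially.) -/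
/-- The lexicographically-first MIS of a simple graph `G` on `Fin n` under the
permutation `π` (position `i` holds vertex `π i`). -/
def LFMIS {n : ℕ} (G : SimpleGraph (Fin n)) (π : Equiv.Perm (Fin n)) : Set (Fin n) :=
  {v | lfmisAux Set.univ G.edgeSet π (π.symm v : ℕ)}

/-- `v` is a remaining vertex with no remaining π-earlier neighbor, so it joins
the MIS in the current round of parallel greedy LFMIS. -/
def localMin {n : ℕ} (G : SimpleGraph (Fin n)) (π : Equiv.Perm (Fin n))
    (W : Set (Fin n)) (v : Fin n) : Prop :=
  v ∈ W ∧ ∀ u ∈ W, G.Adj u v → π.symm v < π.symm u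

/-- One round of parallel greedy LFMIS: every remaining vertex with no remaining
π-earlier neighbor is added to the MIS, and all neighbors of such vertices (and
the vertices themselves) are removed. -/
def parStep {n : ℕ} (G : SimpleGraph (Fin n)) (π : Equiv.Perm (Fin n))
    (W : Set (Fin n)) : Set (Fin n) :=
  {v ∈ W | ¬ localMin G π W v ∧ ∀ u, G.Adj u v → ¬ localMin G π W u}

/-- CHK influence-set propagation for an updated graph `Gnew`, where `M` is the
set of marked vertices (the old LFMIS) and `S0` is the base set: `S_{r}` adds to
`S_{r-1}` every marked vertex with a π-earlier `Gnew`-neighbor in `S_{r-1}`, and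
every unmarked vertex all of whose marked `Gnew`-neighbors lie in `S_{r-1}`. -/
def chkS {n : ℕ} (Gnew : SimpleGraph (Fin n)) (π : Equiv.Perm (Fin n))
    (M : Set (Fin n)) (S0 : Set (Fin n)) : ℕ → Set (Fin n)
  | 0 => S0
  | r + 1 =>
      chkS Gnew π M S0 r ∪
        {v | (v ∈ M ∧ ∃ u ∈ chkS Gnew π M S0 r, Gnew.Adj u v ∧ π.symm u < π.symm v) ∨
          (v ∉ M ∧ ∀ u, Gnew.Adj u v → u ∈ M → u ∈ chkS Gnew π M S0 r)}

/-- The base set for inserting a batch `B` of edges into a graph whose current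
LFMIS is `M`: the π-later endpoint of every inserted edge whose insertion
violates `M` (i.e. both endpoints are marked). -/
def chkBase {n : ℕ} (π : Equiv.Perm (Fin n)) (M : Set (Fin n))
    (B : Set (Sym2 (Fin n))) : Set (Fin n) :=
  {v | v ∈ M ∧ ∃ u ∈ M, s(u, v) ∈ B ∧ π.symm u < π.symm v}

/-- The final (stabilized) CHK influence set. -/
def chkInfluence {n : ℕ} (Gnew : SimpleGraph (Fin n)) (π : Equiv.Perm (Fin n))
    (M : Set (Fin n)) (S0 : Set (Fin n)) : Set (Fin n) :=
  ⋃ r : ℕ, chkS Gnew π M S0 r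

/-- A set that contains the base set and is closed under propagation contains the influence set. -/
theorem chkInfluence_subset {n : ℕ} {G : SimpleGraph (Fin n)} {π : Equiv.Perm (Fin n)}
    {M S T : Set (Fin n)} (hST : S ⊆ T)
    (marked : ∀ v ∈ M, ∀ u ∈ T, G.Adj u v → π.symm u < π.symm v → v ∈ T)
    (unmarked : ∀ v ∉ M, (∀ u, G.Adj u v → u ∈ M → u ∈ T) → v ∈ T) :
    chkInfluence G π M S ⊆ T := by
  refine Set.iUnion_subset fun r => ?_
  induction r with
  | zero => exact hST
  | succ r ih =>
    rintro v (hv | ⟨hv, u, hu, huv, hlt⟩ | ⟨hv, h⟩)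
    · exact ih hv
    · exact marked v hv u (ih hu) huv hlt
    · exact unmarked v hv fun u huv hu => ih (h u huv hu)

/-- A vertex is in the LFMIS iff none of its earlier neighbors is. -/
theorem mem_LFMIS_iff {n : ℕ} {G : SimpleGraph (Fin n)} {π : Equiv.Perm (Fin n)} {v : Fin n} :
    v ∈ LFMIS G π ↔ ∀ u, π.symm u < π.symm v → G.Adj u v → u ∉ LFMIS G π := by
  change lfmisAux _ _ _ _ ↔ _
  rw [lfmisAux]
  constructor
  · rintro ⟨-, h⟩ u hlt hadj
    exact h (π.symm u) hlt ⟨(π.symm u).2, (π.symm v).2, trivial, trivial, by simpa using hadj⟩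
  · refine fun h => ⟨⟨(π.symm v).2, trivial⟩, ?_⟩
    rintro j hj ⟨h1, h2, -, -, hadj⟩
    have := h (π ⟨j, h1⟩) (by simpa [Fin.lt_def] using hj) (by simpa using hadj)
    simpa [LFMIS] using this

theorem LFMIS_bot {n : ℕ} (π : Equiv.Perm (Fin n)) : LFMIS ⊥ π = Set.univ :=
  Set.eq_univ_of_forall fun _ => mem_LFMIS_iff.2 fun _ _ h => h.elim

/-- With vertices `0, 1, 2` in their natural order, the LFMIS of the graph with single edge `01`
is `{0, 2}`. -/
theorem LFMIS_single_edge :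
    LFMIS (SimpleGraph.fromEdgeSet {s((0 : Fin 3), 1)}) 1 = {0, 2} := by
  have h0 : (0 : Fin 3) ∈ LFMIS (SimpleGraph.fromEdgeSet {s((0 : Fin 3), 1)}) 1 :=
    mem_LFMIS_iff.2 fun u hu => absurd hu (Fin.not_lt_zero u)
  have h1 : (1 : Fin 3) ∉ LFMIS (SimpleGraph.fromEdgeSet {s((0 : Fin 3), 1)}) 1 :=
    fun h => mem_LFMIS_iff.1 h 0 (by decide) (by simp) h0
  have h2 : (2 : Fin 3) ∈ LFMIS (SimpleGraph.fromEdgeSet {s((0 : Fin 3), 1)}) 1 :=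
    mem_LFMIS_iff.2 fun u _ hu => by simp at hu
  ext v
  fin_cases v
  · simpa using h0
  · simpa using h1
  · simpa using h2

/-- The batch influence set is not covered by the union of the sequential
single-update influence sets: there are a graph `G`, a permutation `π`, and two
non-edges `a, b` such that some vertex `w` lies in the batch influence set for
inserting `{a, b}` into `G`, but lies neither in the CHK influence set for
inserting `a` alone into `G`, nor in the CHK influence set for inserting `b`
alone into `G + a`. -/
theorem batch_influence_not_union :
    ∃ (n : ℕ) (G : SimpleGraph (Fin n)) (π : Equiv.Perm (Fin n))
      (a b : Sym2 (Fin n)),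
      ¬ a.IsDiag ∧ ¬ b.IsDiag ∧ a ∉ G.edgeSet ∧ b ∉ G.edgeSet ∧ a ≠ b ∧
      ∃ w : Fin n,
        w ∈ chkInfluence (G ⊔ SimpleGraph.fromEdgeSet {a, b}) π (LFMIS G π)
              (chkBase π (LFMIS G π) {a, b}) ∧
        w ∉ chkInfluence (G ⊔ SimpleGraph.fromEdgeSet {a}) π (LFMIS G π)
              (chkBase π (LFMIS G π) {a}) ∧
        w ∉ chkInfluence (G ⊔ SimpleGraph.fromEdgeSet {a, b}) π
              (LFMIS (G ⊔ SimpleGraph.fromEdgeSet {a}) π)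
              (chkBase π (LFMIS (G ⊔ SimpleGraph.fromEdgeSet {a}) π) {b}) := by
  refine ⟨3, ⊥, 1, s(0, 1), s(1, 2), by decide, by decide, by simp, by simp, by decide, 2,
    ?_, ?_, ?_⟩
  · rw [LFMIS_bot]
    exact Set.mem_iUnion.2 ⟨0, trivial, 1, trivial, by simp, by decide⟩
  · rw [LFMIS_bot]
    refine fun h => absurd (chkInfluence_subset (T := {1}) ?_ ?_ ?_ h) (by simp)
    · rintro v ⟨-, u, -, huv, hlt⟩
      revert u v
      simp only [Set.mem_singleton_iff]
      decide
    · rintro v - u rfl huv hlt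
      fin_cases v
      · exact absurd hlt (Fin.not_lt_zero _)
      · rfl
      · simp at huv
    · exact fun v hv => absurd trivial hv
  · rw [bot_sup_eq, bot_sup_eq, LFMIS_single_edge]
    refine fun h => chkInfluence_subset (T := ∅) ?_ ?_ ?_ h
    · rintro v ⟨hv, u, hu, huv, -⟩
      fin_cases v <;> fin_cases u <;> simp_all
    · exact fun _ _ _ hu => hu.elim
    · intro v hv hall
      obtain rfl : v = 1 := by fin_cases v <;> simp_all
      exact hall 0 (by simp) (by simp)
end
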